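/- arXiv:0903.0344 — 2 statements merged into one kernel-verified Lean document; each statement's English description precedes it below -/
import Mathlib

section
/- In the algebra C, the rows of β generate the left annihilator of the matrix γ: the set {(e₁,e₂,e₃,e₄) ∈ C⁴ : e₁v + e₂w + e₃x₁ + e₄y₁ = 0 and e₄z₁ = 0} equals the left C-submodule of C⁴ generated by the six vectors (s,−s,0,0), (0,t,−t,0), (u,0,−u,0), (s,0,0,−s), (0,t,0,−t), (0,0,u,−u). -/
noncomputable section

open FreeAlgebra

/-- Generators of the algebra `C`: `n, p, q, r, s, t, u, v, w`,
`x_1, …, x_{m-2}`, `y_1, …, y_{m-3}`, `z_1, …, z_{m-4}`. -/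
inductive CGen (m : ℕ) : Type
  | n | p | q | r | s | t | u | v | w
  | x (i : ℕ) (h1 : 1 ≤ i) (h2 : i ≤ m - 2)
  | y (i : ℕ) (h1 : 1 ≤ i) (h2 : i ≤ m - 3)
  | z (i : ℕ) (h1 : 1 ≤ i) (h2 : i ≤ m - 4)

/-- The defining relations of `C`, as a relation on the free algebra
(each generator `g` of the ideal contributes the pair `(g, 0)`). -/
inductive CRel (k : Type) [Field k] (m : ℕ) :
    FreeAlgebra k (CGen m) → FreeAlgebra k (CGen m) → Prop
  | np_nq : CRel k m (ι k CGen.n * ι k CGen.p - ι k CGen.n * ι k CGen.q) 0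
  | np_nr : CRel k m (ι k CGen.n * ι k CGen.p - ι k CGen.n * ι k CGen.r) 0
  | ps_pt : CRel k m (ι k CGen.p * ι k CGen.s - ι k CGen.p * ι k CGen.t) 0
  | qt_qu : CRel k m (ι k CGen.q * ι k CGen.t - ι k CGen.q * ι k CGen.u) 0
  | rs_ru : CRel k m (ι k CGen.r * ι k CGen.s - ι k CGen.r * ι k CGen.u) 0
  | sv_sw : CRel k m (ι k CGen.s * ι k CGen.v - ι k CGen.s * ι k CGen.w) 0
  | tw_tx (h : 1 ≤ m - 2) :
      CRel k m (ι k CGen.t * ι k CGen.w - ι k CGen.t * ι k (CGen.x 1 le_rfl h)) 0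
  | uv_ux (h : 1 ≤ m - 2) :
      CRel k m (ι k CGen.u * ι k CGen.v - ι k CGen.u * ι k (CGen.x 1 le_rfl h)) 0
  | vx2 (h : 2 ≤ m - 2) :
      CRel k m (ι k CGen.v * ι k (CGen.x 2 (by omega) h)) 0
  | wx2 (h : 2 ≤ m - 2) :
      CRel k m (ι k CGen.w * ι k (CGen.x 2 (by omega) h)) 0
  | sv_sy (h : 1 ≤ m - 3) :
      CRel k m (ι k CGen.s * ι k CGen.v - ι k CGen.s * ι k (CGen.y 1 le_rfl h)) 0
  | tw_ty (h : 1 ≤ m - 3) :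
      CRel k m (ι k CGen.t * ι k CGen.w - ι k CGen.t * ι k (CGen.y 1 le_rfl h)) 0
  | ux_uy (h2 : 1 ≤ m - 2) (h3 : 1 ≤ m - 3) :
      CRel k m (ι k CGen.u * ι k (CGen.x 1 le_rfl h2) -
        ι k CGen.u * ι k (CGen.y 1 le_rfl h3)) 0
  | sz (h : 1 ≤ m - 4) : CRel k m (ι k CGen.s * ι k (CGen.z 1 le_rfl h)) 0
  | tz (h : 1 ≤ m - 4) : CRel k m (ι k CGen.t * ι k (CGen.z 1 le_rfl h)) 0
  | uz (h : 1 ≤ m - 4) : CRel k m (ι k CGen.u * ι k (CGen.z 1 le_rfl h)) 0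
  | xx (i : ℕ) (h1 : 1 ≤ i) (h2 : i ≤ m - 3) :
      CRel k m (ι k (CGen.x i h1 (by omega)) *
        ι k (CGen.x (i + 1) (by omega) (by omega))) 0
  | yx_zy (i : ℕ) (h1 : 2 ≤ i) (h2 : i ≤ m - 3) :
      CRel k m (ι k (CGen.y (i - 1) (by omega) (by omega)) *
          ι k (CGen.x i (by omega) (by omega)) +
        ι k (CGen.z (i - 1) (by omega) (by omega)) * ι k (CGen.y i (by omega) h2)) 0
  | zz (i : ℕ) (h1 : 1 ≤ i) (h2 : i ≤ m - 5) :
      CRel k m (ι k (CGen.z i h1 (by omega)) *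
        ι k (CGen.z (i + 1) (by omega) (by omega))) 0

/-- The algebra `C`: the quotient of the free algebra by the two-sided ideal
generated by the relations. -/
abbrev Calg (k : Type) [Field k] (m : ℕ) : Type := RingQuot (CRel k m)

/-- The image in `C` of a generator. -/
def cgen (k : Type) [Field k] (m : ℕ) (g : CGen m) : Calg k m :=
  RingQuot.mkAlgHom k (CRel k m) (ι k g)

def cn (k : Type) [Field k] (m : ℕ) : Calg k m := cgen k m CGen.n
def cp (k : Type) [Field k] (m : ℕ) : Calg k m := cgen k m CGen.p
def cq (k : Type) [Field k] (m : ℕ) : Calg k m := cgen k m CGen.q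
def cr (k : Type) [Field k] (m : ℕ) : Calg k m := cgen k m CGen.r
def cs (k : Type) [Field k] (m : ℕ) : Calg k m := cgen k m CGen.s
def ct (k : Type) [Field k] (m : ℕ) : Calg k m := cgen k m CGen.t
def cu (k : Type) [Field k] (m : ℕ) : Calg k m := cgen k m CGen.u
def cv (k : Type) [Field k] (m : ℕ) : Calg k m := cgen k m CGen.v
def cw (k : Type) [Field k] (m : ℕ) : Calg k m := cgen k m CGen.w
def cx (k : Type) [Field k] (m : ℕ) (i : ℕ) (h1 : 1 ≤ i) (h2 : i ≤ m - 2) : Calg k m :=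
  cgen k m (CGen.x i h1 h2)
def cy (k : Type) [Field k] (m : ℕ) (i : ℕ) (h1 : 1 ≤ i) (h2 : i ≤ m - 3) : Calg k m :=
  cgen k m (CGen.y i h1 h2)
def cz (k : Type) [Field k] (m : ℕ) (i : ℕ) (h1 : 1 ≤ i) (h2 : i ≤ m - 4) : Calg k m :=
  cgen k m (CGen.z i h1 h2)

theorem neg_mul_calg {k : Type} [Field k] {m : ℕ} (a b : Calg k m) : -a * b = -(a * b) :=
  neg_mul a b

/-- The rows of `β`. -/
def betaRows (k : Type) [Field k] (m : ℕ) : Set (Fin 4 → Calg k m) :=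
  {![cs k m, -cs k m, 0, 0], ![0, ct k m, -ct k m, 0],
    ![cu k m, 0, -cu k m, 0], ![cs k m, 0, 0, -cs k m],
    ![0, ct k m, 0, -ct k m], ![0, 0, cu k m, -cu k m]}

section Extension

variable {k : Type} [Field k] {m : ℕ} {M : Type} [AddCommGroup M] [Module k M]
  [Module (Calg k m) M] [IsScalarTower k (Calg k m) M]

/-- A generator `g` acts on `M × k` by `(a, c) ↦ (g • a + c • ε g, 0)`. -/
def genAction (ε : CGen m → M) (g : CGen m) : Module.End k (M × k) :=
  LinearMap.inl k M k ∘ₗ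
    (Algebra.lsmul k k M (cgen k m g)).coprod (LinearMap.toSpanSingleton k M (ε g))

theorem genAction_apply (ε : CGen m → M) (g : CGen m) (a : M) (c : k) :
    genAction ε g (a, c) = (cgen k m g • a + c • ε g, 0) := by
  simp [genAction]

/-- The action of the free algebra on `M × k` extending `genAction`. -/
def freeAction (ε : CGen m → M) : FreeAlgebra k (CGen m) →ₐ[k] Module.End k (M × k) :=
  FreeAlgebra.lift k (genAction ε)

theorem freeAction_ι (ε : CGen m → M) (g : CGen m) (a : M) (c : k) :
    freeAction ε (ι k g) (a, c) = (cgen k m g • a + c • ε g, 0) := by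
  simp [freeAction, genAction_apply]

theorem freeAction_inl (ε : CGen m → M) (f : FreeAlgebra k (CGen m)) (a : M) :
    freeAction ε f (a, 0) = (RingQuot.mkAlgHom k (CRel k m) f • a, 0) := by
  induction f using FreeAlgebra.induction generalizing a with
  | grade0 r =>
    rw [AlgHom.commutes, AlgHom.commutes, Module.algebraMap_end_apply, algebraMap_smul]
    simp
  | grade1 g => simp [freeAction_ι, cgen]
  | mul f g hf hg => simp [hf, hg, mul_smul]
  | add f g hf hg => simp [hf, hg, add_smul]

theorem freeAction_eq_zero_of_rel (ε : CGen m → M) {f g : FreeAlgebra k (CGen m)}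
    (h : CRel k m f g) (hf : freeAction ε f (0, 1) = freeAction ε g (0, 1)) :
    freeAction ε f = freeAction ε g := by
  refine LinearMap.prod_ext (LinearMap.ext fun a => ?_) (LinearMap.ext_ring ?_)
  · simp [freeAction_inl, RingQuot.mkAlgHom_rel k h]
  · simpa using hf

/-- If the values `ε g` satisfy the relations of `C`, read off at the last letter, then a relation
`∑ e i * g i = 0` in `C` gives `∑ e i • ε (g i) = 0`. -/
theorem sum_smul_eq_zero (ε : CGen m → M)
    (hε : ∀ f g, CRel k m f g → freeAction ε f (0, 1) = freeAction ε g (0, 1))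
    {ι' : Type} [Fintype ι'] (e : ι' → Calg k m) (g : ι' → CGen m)
    (h : ∑ i, e i * cgen k m (g i) = 0) : ∑ i, e i • ε (g i) = 0 := by
  let φ : Calg k m →ₐ[k] Module.End k (M × k) := RingQuot.liftAlgHom k
    ⟨freeAction ε, fun {f g} hr => freeAction_eq_zero_of_rel ε hr (hε f g hr)⟩
  have hφ (f) : φ (RingQuot.mkAlgHom k (CRel k m) f) = freeAction ε f :=
    RingQuot.liftAlgHom_mkAlgHom_apply _ _ _ _
  have key (c : Calg k m) (g : CGen m) : φ (c * cgen k m g) (0, 1) = (c • ε g, 0) := by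
    obtain ⟨f, rfl⟩ := RingQuot.mkAlgHom_surjective k (CRel k m) c
    rw [cgen, ← map_mul, hφ, map_mul, Module.End.mul_apply, freeAction_ι]
    simp [freeAction_inl]
  have h0 := congrArg (fun c => (φ c (0, 1)).1) h
  simpa [key, Prod.fst_sum, -map_mul] using h0

end Extension

/-- The coordinate vector of `C⁴` attached to a generator: `v`, `w`, `x₁`, `y₁` give the standard
basis, all other generators give zero. -/
def coordVec (k : Type) [Field k] (m : ℕ) : CGen m → Fin 4 → Calg k m
  | .v => Pi.single 0 1
  | .w => Pi.single 1 1
  | .x i _ _ => if i = 1 then Pi.single 2 1 else 0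
  | .y i _ _ => if i = 1 then Pi.single 3 1 else 0
  | _ => 0

theorem freeAction_coordVec_rel {k : Type} [Field k] {m : ℕ} (f g : FreeAlgebra k (CGen m))
    (h : CRel k m f g) :
    freeAction ((Submodule.span (Calg k m) (betaRows k m)).mkQ ∘ coordVec k m) f (0, 1) =
      freeAction ((Submodule.span (Calg k m) (betaRows k m)).mkQ ∘ coordVec k m) g (0, 1) := by
  have hrow {a b c : Fin 4 → Calg k m} (g : CGen m) (hc : c ∈ betaRows k m)
      (hab : cgen k m g • a - cgen k m g • b = c) :
      cgen k m g • (Submodule.Quotient.mk a : _ ⧸ Submodule.span (Calg k m) (betaRows k m)) -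
        cgen k m g • Submodule.Quotient.mk b = 0 := by
    rw [← Submodule.Quotient.mk_smul, ← Submodule.Quotient.mk_smul, ← Submodule.Quotient.mk_sub,
      Submodule.Quotient.mk_eq_zero, hab]
    exact Submodule.subset_span hc
  cases h
  case xx i h1 _ => simp [freeAction_ι, coordVec, show i ≠ 0 by omega]
  case yx_zy i h1 _ => simp [freeAction_ι, coordVec, show i ≠ 1 by omega]
  case sv_sw =>
    have := hrow (a := Pi.single 0 1) (b := Pi.single 1 1) .s
      (show ![cs k m, -cs k m, 0, 0] ∈ betaRows k m by simp [betaRows])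
      (by ext i; fin_cases i <;> simp [cs])
    simpa [freeAction_ι, coordVec] using this
  case tw_tx =>
    have := hrow (a := Pi.single 1 1) (b := Pi.single 2 1) .t
      (show ![0, ct k m, -ct k m, 0] ∈ betaRows k m by simp [betaRows])
      (by ext i; fin_cases i <;> simp [ct])
    simpa [freeAction_ι, coordVec] using this
  case uv_ux =>
    have := hrow (a := Pi.single 0 1) (b := Pi.single 2 1) .u
      (show ![cu k m, 0, -cu k m, 0] ∈ betaRows k m by simp [betaRows])
      (by ext i; fin_cases i <;> simp [cu])
    simpa [freeAction_ι, coordVec] using this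
  case sv_sy =>
    have := hrow (a := Pi.single 0 1) (b := Pi.single 3 1) .s
      (show ![cs k m, 0, 0, -cs k m] ∈ betaRows k m by simp [betaRows])
      (by ext i; fin_cases i <;> simp [cs])
    simpa [freeAction_ι, coordVec] using this
  case tw_ty =>
    have := hrow (a := Pi.single 1 1) (b := Pi.single 3 1) .t
      (show ![0, ct k m, 0, -ct k m] ∈ betaRows k m by simp [betaRows])
      (by ext i; fin_cases i <;> simp [ct])
    simpa [freeAction_ι, coordVec] using this
  case ux_uy =>
    have := hrow (a := Pi.single 2 1) (b := Pi.single 3 1) .u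
      (show ![0, 0, cu k m, -cu k m] ∈ betaRows k m by simp [betaRows])
      (by ext i; fin_cases i <;> simp [cu])
    simpa [freeAction_ι, coordVec] using this
  all_goals simp [freeAction_ι, coordVec]

theorem mul_of_rel {k : Type} [Field k] {m : ℕ} {a b c d : CGen m}
    (h : CRel k m (ι k a * ι k b - ι k c * ι k d) 0) :
    cgen k m a * cgen k m b = cgen k m c * cgen k m d := by
  simpa [sub_eq_zero, cgen] using RingQuot.mkAlgHom_rel k h

theorem mul_eq_zero_of_rel {k : Type} [Field k] {m : ℕ} {a b : CGen m}
    (h : CRel k m (ι k a * ι k b) 0) : cgen k m a * cgen k m b = 0 := by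
  simpa [cgen] using RingQuot.mkAlgHom_rel k h

/-- In the algebra `C`, the rows of `β` generate the left
annihilator of the matrix `γ`. -/
theorem stmt11 (k : Type) [Field k] (m : ℕ) (hm : 5 ≤ m) :
    {e : Fin 4 → Calg k m |
        e 0 * cv k m + e 1 * cw k m + e 2 * cx k m 1 (by omega) (by omega) +
          e 3 * cy k m 1 (by omega) (by omega) = 0 ∧
        e 3 * cz k m 1 (by omega) (by omega) = 0}
      = (Submodule.span (Calg k m)
          {![cs k m, -cs k m, 0, 0], ![0, ct k m, -ct k m, 0],
           ![cu k m, 0, -cu k m, 0], ![cs k m, 0, 0, -cs k m],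
           ![0, ct k m, 0, -ct k m], ![0, 0, cu k m, -cu k m]} :
            Set (Fin 4 → Calg k m)) := by
  ext e
  change _ ↔ e ∈ Submodule.span (Calg k m) (betaRows k m)
  constructor
  · rintro ⟨h, -⟩
    have h0 := sum_smul_eq_zero _ freeAction_coordVec_rel e
      ![.v, .w, .x 1 le_rfl (by omega), .y 1 le_rfl (by omega)]
      (by simpa [Fin.sum_univ_four, cv, cw, cx, cy] using h)
    rw [← Submodule.Quotient.mk_eq_zero, ← Submodule.mkQ_apply]
    rw [← h0]
    simp only [Function.comp_apply, ← map_smul, ← map_sum]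
    congr 1
    ext i
    fin_cases i <;> simp [Fin.sum_univ_four, coordVec]
  · intro he
    have h1 := mul_of_rel (CRel.sv_sw (k := k) (m := m))
    have h2 := mul_of_rel (CRel.tw_tx (k := k) (m := m) (by omega))
    have h3 := mul_of_rel (CRel.uv_ux (k := k) (m := m) (by omega))
    have h4 := h1.symm.trans (mul_of_rel (CRel.sv_sy (k := k) (m := m) (by omega)))
    have h5 := h2.symm.trans (mul_of_rel (CRel.tw_ty (k := k) (m := m) (by omega)))
    have h6 := mul_of_rel (CRel.ux_uy (k := k) (m := m) (by omega) (by omega))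
    have h7 := mul_eq_zero_of_rel (CRel.sz (k := k) (m := m) (by omega))
    have h8 := mul_eq_zero_of_rel (CRel.tz (k := k) (m := m) (by omega))
    have h9 := mul_eq_zero_of_rel (CRel.uz (k := k) (m := m) (by omega))
    induction he using Submodule.span_induction with
    | mem e he =>
      rcases he with rfl | rfl | rfl | rfl | rfl | rfl <;>
        simp [cs, ct, cu, cv, cw, cx, cy, cz, neg_mul_calg, *]
    | zero => simp
    | add a b _ _ ha hb =>
      refine ⟨?_, by simp [add_mul, ha.2, hb.2]⟩
      rw [← add_zero (0 : Calg k m)]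
      nth_rw 1 [← ha.1]
      rw [← hb.1]
      simp only [Pi.add_apply, add_mul]
      abel
    | smul c a _ ha =>
      refine ⟨?_, by simp [mul_assoc, ha.2]⟩
      rw [← mul_zero c, ← ha.1]
      simp [mul_add, mul_assoc]
end
end

section
/- In the algebra C, for every i with 3 ≤ i ≤ m−2, the element x_{i−1} generates the left annihilator of x_i: {c ∈ C : c·x_i = 0} = C·x_{i−1}. -/
noncomputable section

open FreeAlgebra

section AffineExtension

variable {k X : Type*} [Field k] {r : FreeAlgebra k X → FreeAlgebra k X → Prop}
  {M : Type*} [AddCommGroup M] [Module k M] [Module (RingQuot r) M]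
  [IsScalarTower k (RingQuot r) M]

/-- The endomorphism `(μ, l) ↦ (x • μ + l • f x, 0)` of `M × k` attached to a generator `x`. -/
def extEnd (r : FreeAlgebra k X → FreeAlgebra k X → Prop) [Module (RingQuot r) M]
    [IsScalarTower k (RingQuot r) M] (f : X → M) (x : X) : Module.End k (M × k) :=
  LinearMap.inl k M k ∘ₗ
    ((Algebra.lsmul k k M (RingQuot.mkAlgHom k r (ι k x))).coprod
      (LinearMap.toSpanSingleton k M (f x)))

theorem extEnd_apply (f : X → M) (x : X) (v : M × k) :
    extEnd r f x v = (RingQuot.mkAlgHom k r (ι k x) • v.1 + v.2 • f x, 0) := by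
  simp [extEnd]

theorem lift_extEnd_apply_inl (f : X → M) (a : FreeAlgebra k X) (μ : M) :
    FreeAlgebra.lift k (extEnd r f) a (μ, 0) = (RingQuot.mkAlgHom k r a • μ, 0) := by
  induction a using FreeAlgebra.induction generalizing μ with
  | grade0 c => simp [Algebra.algebraMap_eq_smul_one]
  | grade1 x => simp [extEnd_apply]
  | mul a b ha hb => simp [ha, hb, mul_smul]
  | add a b ha hb => simp [ha, hb, add_smul]

/-- If the assignment `f` of generators to elements of `M` is compatible with the relations,
then `c * x = 0` forces `c • f x = 0`. -/
theorem smul_eq_zero_of_mul_generator_eq_zero (f : X → M)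
    (hf : ∀ a b, r a b → FreeAlgebra.lift k (extEnd r f) a (0, 1) =
      FreeAlgebra.lift k (extEnd r f) b (0, 1))
    (x : X) (c : RingQuot r) (hc : c * RingQuot.mkAlgHom k r (ι k x) = 0) :
    c • f x = 0 := by
  have hrel : ∀ ⦃a b⦄, r a b →
      FreeAlgebra.lift k (extEnd r f) a = FreeAlgebra.lift k (extEnd r f) b := by
    intro a b hab
    refine LinearMap.prod_ext (LinearMap.ext fun μ => ?_) (LinearMap.ext_ring ?_)
    · simp [lift_extEnd_apply_inl, RingQuot.mkAlgHom_rel k hab]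
    · simpa using hf a b hab
  obtain ⟨c, rfl⟩ := RingQuot.mkAlgHom_surjective k r c
  have h := congrArg (fun a => RingQuot.liftAlgHom k ⟨_, hrel⟩ a ((0 : M), (1 : k))) hc
  simpa [RingQuot.liftAlgHom_mkAlgHom_apply, extEnd_apply, lift_extEnd_apply_inl] using h

end AffineExtension

theorem sub_mul_eq_add_mul_of_add_eq_zero {R : Type*} [Ring R] {x y z w b d : R}
    (h : y * x + z * w = 0) : (b - d * y) * x = b * x + d * z * w := by
  rw [sub_mul, mul_assoc, eq_neg_of_add_eq_zero_left h, mul_neg, sub_neg_eq_add, mul_assoc]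

section Annihilators

variable {k : Type} [Field k] {m : ℕ}

theorem cx_mul_cx (j : ℕ) (h1 : 1 ≤ j) (h2 : j + 1 ≤ m - 2) :
    cx k m j h1 (by omega) * cx k m (j + 1) (by omega) h2 = 0 := by
  simpa [cx, cgen] using RingQuot.mkAlgHom_rel k (CRel.xx (k := k) (m := m) j h1 (by omega))

theorem cy_mul_cx_add_cz_mul_cy (j : ℕ) (h1 : 1 ≤ j) (h2 : j + 1 ≤ m - 3) :
    cy k m j h1 (by omega) * cx k m (j + 1) (by omega) (by omega) +
      cz k m j h1 (by omega) * cy k m (j + 1) (by omega) h2 = 0 := by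
  simpa [cx, cy, cz, cgen] using
    RingQuot.mkAlgHom_rel k (CRel.yx_zy (k := k) (m := m) (j + 1) (by omega) h2)

theorem smul_eq_zero_of_mul_cz_eq_zero {M : Type*} [AddCommGroup M] [Module k M]
    [Module (Calg k m) M] [IsScalarTower k (Calg k m) M] (j : ℕ) (h1 : 1 ≤ j)
    (h2 : j + 1 ≤ m - 4) (e : M) (hz : cz k m j h1 (by omega) • e = 0)
    (a : Calg k m) (ha : a * cz k m (j + 1) (by omega) h2 = 0) : a • e = 0 := by
  let f : CGen m → M
    | .z l _ _ => if l = j + 1 then e else 0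
    | _ => 0
  have hfz : f (.z (j + 1) (by omega) h2) = e := by simp [f]
  rw [← hfz]
  refine smul_eq_zero_of_mul_generator_eq_zero f ?_ (.z (j + 1) (by omega) h2) a ha
  have hne : j ≠ 0 := by omega
  intro a b hab
  cases hab with
  | zz l hl1 hl2 =>
    by_cases hlj : l = j
    · subst hlj
      simpa [extEnd_apply, f, cz, cgen] using hz
    · simp [extEnd_apply, f, hlj]
  | _ => simp [extEnd_apply, f, hne]

theorem exists_mul_cz_eq_of_mul_cz_eq_zero (j : ℕ) (h1 : 1 ≤ j) (h2 : j + 1 ≤ m - 4)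
    (a : Calg k m) (ha : a * cz k m (j + 1) (by omega) h2 = 0) :
    ∃ b, b * cz k m j h1 (by omega) = a := by
  let S := Submodule.span (Calg k m) {cz k m j h1 (by omega)}
  have h := smul_eq_zero_of_mul_cz_eq_zero j h1 h2 (S.mkQ 1) ?_ a ha
  · rw [← map_smul, smul_eq_mul, mul_one] at h
    exact Submodule.mem_span_singleton.1 ((Submodule.Quotient.mk_eq_zero S).1 h)
  · rw [← map_smul, smul_eq_mul, mul_one]
    exact (Submodule.Quotient.mk_eq_zero S).2 (Submodule.mem_span_singleton_self _)

theorem smul_eq_zero_of_mul_cx_eq_zero {M : Type*} [AddCommGroup M] [Module k M]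
    [Module (Calg k m) M] [IsScalarTower k (Calg k m) M] (j : ℕ) (h1 : 2 ≤ j)
    (h2 : j + 1 ≤ m - 2) (e₁ e₂ : M) (hx : cx k m j (by omega) (by omega) • e₁ = 0)
    (hyz : ∀ h : j + 1 ≤ m - 3, cy k m j (by omega) (by omega) • e₁ +
      cz k m j (by omega) (by omega) • e₂ = 0)
    (c : Calg k m) (hc : c * cx k m (j + 1) (by omega) h2 = 0) : c • e₁ = 0 := by
  let f : CGen m → M
    | .x l _ _ => if l = j + 1 then e₁ else 0
    | .y l _ _ => if l = j + 1 then e₂ else 0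
    | _ => 0
  have hfx : f (.x (j + 1) (by omega) h2) = e₁ := by simp [f]
  rw [← hfx]
  refine smul_eq_zero_of_mul_generator_eq_zero f ?_ (.x (j + 1) (by omega) h2) c hc
  have hne₀ : j ≠ 0 := by omega
  have hne₁ : j ≠ 1 := by omega
  intro a b hab
  cases hab with
  | xx l hl1 hl2 =>
    by_cases hlj : l = j
    · subst hlj
      simpa [extEnd_apply, f, cx, cgen] using hx
    · simp [extEnd_apply, f, hlj]
  | yx_zy l hl1 hl2 =>
    by_cases hlj : l = j + 1
    · subst hlj
      simpa [extEnd_apply, f, cy, cz, cgen] using hyz hl2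
    · simp [extEnd_apply, f, hlj]
  | _ => simp [extEnd_apply, f, hne₀, hne₁]

theorem exists_mul_cx_eq_of_mul_cx_eq_zero (j : ℕ) (h1 : 2 ≤ j) (h2 : j + 1 ≤ m - 2)
    (c : Calg k m) (hc : c * cx k m (j + 1) (by omega) h2 = 0) :
    ∃ b, b * cx k m j (by omega) (by omega) = c := by
  by_cases hj : j + 1 ≤ m - 3
  · let S := Submodule.span (Calg k m)
      {(cx k m j (by omega) (by omega), (0 : Calg k m)),
        (cy k m j (by omega) (by omega), cz k m j (by omega) (by omega))}
    have h := smul_eq_zero_of_mul_cx_eq_zero j h1 h2 (S.mkQ (1, 0)) (S.mkQ (0, 1)) ?_ ?_ c hc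
    · rw [← map_smul] at h
      obtain ⟨b, a, hab⟩ :=
        Submodule.mem_span_pair.1 ((Submodule.Quotient.mk_eq_zero S).1 h)
      simp only [Prod.smul_mk, Prod.mk_add_mk, smul_eq_mul, mul_zero, mul_one, zero_add,
        Prod.mk.injEq] at hab
      obtain ⟨l, rfl⟩ : ∃ l, j = l + 1 := ⟨j - 1, by omega⟩
      obtain ⟨d, rfl⟩ :=
        exists_mul_cz_eq_of_mul_cz_eq_zero l (by omega) (by omega) a hab.2
      have hyx := cy_mul_cx_add_cz_mul_cy (k := k) (m := m) l (by omega) (by omega)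
      refine ⟨b - d * cy k m l (by omega) (by omega), ?_⟩
      rw [← hab.1, sub_mul_eq_add_mul_of_add_eq_zero hyx]
    · rw [← map_smul]
      refine (Submodule.Quotient.mk_eq_zero S).2 (Submodule.subset_span ?_)
      simp
    · intro _
      rw [← map_smul, ← map_smul, ← map_add]
      refine (Submodule.Quotient.mk_eq_zero S).2 (Submodule.subset_span ?_)
      simp
  · let S := Submodule.span (Calg k m) {cx k m j (by omega) (by omega)}
    have h := smul_eq_zero_of_mul_cx_eq_zero j h1 h2 (S.mkQ 1) 0 ?_ (fun h => absurd h hj) c hc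
    · rw [← map_smul, smul_eq_mul, mul_one] at h
      exact Submodule.mem_span_singleton.1 ((Submodule.Quotient.mk_eq_zero S).1 h)
    · rw [← map_smul, smul_eq_mul, mul_one]
      exact (Submodule.Quotient.mk_eq_zero S).2 (Submodule.mem_span_singleton_self _)

end Annihilators

/-- In the algebra `C`, for every `i` with `3 ≤ i ≤ m−2`, the
element `x_{i−1}` generates the left annihilator of `x_i`:
`{c ∈ C : c·x_i = 0} = C·x_{i−1}`. -/
theorem stmt14 (k : Type) [Field k] (m : ℕ) (hm : 5 ≤ m) :
    ∀ (i : ℕ) (h1 : 3 ≤ i) (h2 : i ≤ m - 2),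
      {c : Calg k m | c * cx k m i (by omega) (by omega) = 0}
        = (Submodule.span (Calg k m)
            {cx k m (i - 1) (by omega) (by omega)} : Set (Calg k m)) := by
  intro i h1 h2
  obtain ⟨j, rfl⟩ : ∃ j, i = j + 1 := ⟨i - 1, by omega⟩
  ext c
  simp only [Set.mem_ofPred_eq, SetLike.mem_coe, Submodule.mem_span_singleton, smul_eq_mul]
  refine ⟨exists_mul_cx_eq_of_mul_cx_eq_zero j (by omega) h2 c, ?_⟩
  rintro ⟨b, rfl⟩
  have h := cx_mul_cx (k := k) j (by omega) h2
  simp [mul_assoc, h]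
end
end
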